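/- Let S ⊆ ℝ be measurable, r : ℝ → ℝ measurable, and suppose Assumption (A) holds with constant Γ₀. Then lim_{Γ→∞} h*(Γ) = log λ(S), where λ(S) is the Lebesgue measure of S, and where log λ(S) is interpreted as +∞ when λ(S) = ∞. -/

import Mathlib

open MeasureTheory ENNReal Filter

noncomputable section

/-- `f` is a probability density (w.r.t. Lebesgue measure) on `ℝ`. -/
def IsDensity1 (f : ℝ → ℝ) : Prop :=
  Measurable f ∧ (∀ x, 0 ≤ f x) ∧ ∫⁻ x, ENNReal.ofReal (f x) = 1

/-- `∫ (f log f)⁺`, the positive part of `∫ f log f`. -/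
def shannonNegPart (f : ℝ → ℝ) : ℝ≥0∞ := ∫⁻ x, ENNReal.ofReal (f x * Real.log (f x))

/-- `∫ (f log f)⁻`, the negative part of `∫ f log f`. -/
def shannonPosPart (f : ℝ → ℝ) : ℝ≥0∞ := ∫⁻ x, ENNReal.ofReal (-(f x * Real.log (f x)))

/-- The differential Shannon entropy `-∫ f log f` is defined (possibly `±∞`): the positive
and negative parts of the integral are not both infinite. -/
def ShannonDefined (f : ℝ → ℝ) : Prop := shannonPosPart f ≠ ∞ ∨ shannonNegPart f ≠ ∞

/-- Differential Shannon entropy `-∫ f log f`, as an extended real. -/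
def shannonEntropy (f : ℝ → ℝ) : EReal :=
  (shannonPosPart f : EReal) - (shannonNegPart f : EReal)

/-- `∫ f(x) r(x) dx ≤ Γ`: the positive part of the integral is finite and the integral,
with values in the extended reals (possibly `-∞`), is at most `Γ`. -/
def CostLE (f r : ℝ → ℝ) (Γ : ℝ) : Prop :=
  (∫⁻ x, ENNReal.ofReal (f x * r x)) ≠ ∞ ∧
  ((∫⁻ x, ENNReal.ofReal (f x * r x) : ℝ≥0∞) : EReal)
      - ((∫⁻ x, ENNReal.ofReal (-(f x * r x)) : ℝ≥0∞) : EReal) ≤ (Γ : EReal)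

/-- `h⋆(Γ)`: the supremum of the Shannon entropy `h(f)` over all densities `f` supported by
`S` with `∫ f·r ≤ Γ` (and with `h(f)` defined); it is `⊥` if no such density exists. -/
def hStar (S : Set ℝ) (r : ℝ → ℝ) (Γ : ℝ) : EReal :=
  sSup {h : EReal | ∃ f : ℝ → ℝ, IsDensity1 f ∧ (∀ x ∉ S, f x = 0) ∧
    ShannonDefined f ∧ CostLE f r Γ ∧ h = shannonEntropy f}

/-- `log λ(S)`, with the conventions `log ∞ = +∞` and `log 0 = -∞`. -/
def logVol (S : Set ℝ) : EReal :=
  if volume S = ∞ then (⊤ : EReal)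
  else if volume S = 0 then (⊥ : EReal)
  else ((Real.log (volume S).toReal : ℝ) : EReal)

theorem logVol_eq_log_volume (S : Set ℝ) : logVol S = ENNReal.log (volume S) := by
  unfold logVol ENNReal.log
  split_ifs <;> simp_all

theorem lintegral_ofReal_ne_top_of_integrable {g : ℝ → ℝ} (hg : Integrable g) :
    ∫⁻ x, ENNReal.ofReal (g x) ≠ ∞ :=
  ((lintegral_mono fun x => Real.ofReal_le_enorm (g x)).trans_lt hg.2).ne

theorem lintegral_ofReal_sub_lintegral_ofReal_neg {g : ℝ → ℝ} (hg : Integrable g) :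
    ((∫⁻ x, ENNReal.ofReal (g x) : ℝ≥0∞) : EReal)
      - ((∫⁻ x, ENNReal.ofReal (-g x) : ℝ≥0∞) : EReal) = ((∫ x, g x : ℝ) : EReal) := by
  rw [integral_eq_lintegral_pos_part_sub_lintegral_neg_part hg, EReal.coe_sub,
    EReal.coe_ennreal_toReal (lintegral_ofReal_ne_top_of_integrable hg),
    EReal.coe_ennreal_toReal (by simpa using lintegral_ofReal_ne_top_of_integrable hg.neg)]

theorem IsDensity1.integrable {f : ℝ → ℝ} (hf : IsDensity1 f) : Integrable f := by
  refine ⟨hf.1.aestronglyMeasurable, ?_⟩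
  rw [hasFiniteIntegral_iff_ofReal (Eventually.of_forall hf.2.1), hf.2.2]
  exact ENNReal.one_lt_top

theorem IsDensity1.integral_eq_one {f : ℝ → ℝ} (hf : IsDensity1 f) : ∫ x, f x = 1 := by
  rw [integral_eq_lintegral_of_nonneg_ae (Eventually.of_forall hf.2.1)
    hf.1.aestronglyMeasurable, hf.2.2, ENNReal.toReal_one]

theorem neg_mul_log_le {V t : ℝ} (hV : 0 < V) (ht : 0 ≤ t) :
    -(t * Real.log t) ≤ V⁻¹ + t * (Real.log V - 1) := by
  rcases ht.eq_or_lt with rfl | ht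
  · simpa using hV.le
  · have h := Real.log_le_sub_one_of_pos (inv_pos.2 (mul_pos hV ht))
    rw [Real.log_inv, Real.log_mul hV.ne' ht.ne'] at h
    have h' := mul_le_mul_of_nonneg_left h ht.le
    have e : t * ((V * t)⁻¹ - 1) = V⁻¹ - t := by field_simp
    rw [e] at h'
    linarith

theorem shannonEntropy_le_log_volume {S : Set ℝ} (hS : MeasurableSet S) {f : ℝ → ℝ}
    (hf : IsDensity1 f) (hfS : ∀ x ∉ S, f x = 0) :
    shannonEntropy f ≤ ENNReal.log (volume S) := by
  rcases eq_or_ne (volume S) ∞ with hT | hT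
  · simp [hT]
  have h0 : volume S ≠ 0 := fun h0 => by
    have hz : f =ᵐ[volume] 0 := by
      filter_upwards [measure_eq_zero_iff_ae_notMem.1 h0] with x hx using hfS x hx
    have h1 := hf.integral_eq_one
    rw [integral_congr_ae hz] at h1
    simp at h1
  set V := (volume S).toReal with hVdef
  have hV : 0 < V := ENNReal.toReal_pos h0 hT
  set g : ℝ → ℝ := fun x => S.indicator (fun _ => V⁻¹) x + f x * (Real.log V - 1) with hg
  have hi1 : Integrable (S.indicator (fun _ => V⁻¹)) :=
    (integrable_indicator_iff hS).2 (integrableOn_const hT)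
  have hi2 : Integrable (fun x => f x * (Real.log V - 1)) := hf.integrable.mul_const _
  have hgi : Integrable g := hi1.add hi2
  have hle : ∀ x, -(f x * Real.log (f x)) ≤ g x := fun x => by
    by_cases hx : x ∈ S
    · simpa [hg, hx] using neg_mul_log_le hV (hf.2.1 x)
    · simp [hg, hx, hfS x hx]
  have hint : ∫ x, g x = Real.log V := by
    rw [hg, integral_add hi1 hi2, integral_indicator_const _ hS, integral_mul_const,
      hf.integral_eq_one, measureReal_def, ← hVdef, smul_eq_mul, mul_inv_cancel₀ hV.ne']
    ring
  have hP : shannonPosPart f ≠ ∞ :=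
    ((lintegral_mono fun x => ENNReal.ofReal_le_ofReal (hle x)).trans_lt
      (lintegral_ofReal_ne_top_of_integrable hgi).lt_top).ne
  rw [ENNReal.log_pos_real h0 hT, ← hVdef, ← hint]
  by_cases hN : shannonNegPart f = ∞
  · simp [shannonEntropy, hN]
  have hm : Measurable fun x => f x * Real.log (f x) := hf.1.mul hf.1.log
  have hfi : Integrable fun x => -(f x * Real.log (f x)) := by
    refine ⟨hm.neg.aestronglyMeasurable, ?_⟩
    have hb : ∀ x, ‖-(f x * Real.log (f x))‖ₑ ≤ ENNReal.ofReal (-(f x * Real.log (f x)))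
        + ENNReal.ofReal (f x * Real.log (f x)) := fun x => by
      rw [Real.enorm_eq_ofReal_abs, abs_neg]
      rcases abs_cases (f x * Real.log (f x)) with h | h <;> simp [h.1]
    refine (lintegral_mono hb).trans_lt ?_
    rw [lintegral_add_right _ hm.ennreal_ofReal]
    exact ENNReal.add_lt_top.2 ⟨hP.lt_top, Ne.lt_top hN⟩
  have h := lintegral_ofReal_sub_lintegral_ofReal_neg hfi
  simp only [neg_neg] at h
  rw [shannonEntropy, shannonPosPart, shannonNegPart, h]
  exact EReal.coe_le_coe_iff.2 (integral_mono hfi hgi hle)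

theorem hStar_le_log_volume {S : Set ℝ} (hS : MeasurableSet S) (r : ℝ → ℝ) (Γ : ℝ) :
    hStar S r Γ ≤ ENNReal.log (volume S) := by
  refine sSup_le ?_
  rintro _ ⟨f, hf, hfS, -, -, rfl⟩
  exact shannonEntropy_le_log_volume hS hf hfS

/-- The uniform density on `T` is admissible as soon as `|r| ≤ Γ` on `T`. -/
theorem log_volume_le_hStar {S T : Set ℝ} (hT : MeasurableSet T) (hTS : T ⊆ S)
    (hfin : volume T ≠ ∞) {r : ℝ → ℝ} (hr : Measurable r) {Γ : ℝ} (hrT : ∀ x ∈ T, |r x| ≤ Γ) :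
    ENNReal.log (volume T) ≤ hStar S r Γ := by
  rcases eq_or_ne (volume T) 0 with h0 | h0
  · simp [h0]
  set V := (volume T).toReal with hVdef
  have hV : 0 < V := ENNReal.toReal_pos h0 hfin
  set f : ℝ → ℝ := T.indicator (fun _ => V⁻¹) with hfdef
  have hind : ∀ c : ℝ, Integrable (T.indicator (fun _ => c)) := fun c =>
    (integrable_indicator_iff hT).2 (integrableOn_const hfin)
  have hf : IsDensity1 f := by
    refine ⟨measurable_const.indicator hT,
      Set.indicator_nonneg fun _ _ => inv_nonneg.2 hV.le, ?_⟩
    rw [← ofReal_integral_eq_lintegral_ofReal (hind _) (Eventually.of_forall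
      (Set.indicator_nonneg fun _ _ => inv_nonneg.2 hV.le)),
      integral_indicator_const _ hT, measureReal_def, ← hVdef, smul_eq_mul,
      mul_inv_cancel₀ hV.ne', ENNReal.ofReal_one]
  have hlog : (fun x => -(f x * Real.log (f x)))
      = T.indicator (fun _ => V⁻¹ * Real.log V) := by
    ext x
    by_cases hx : x ∈ T <;> simp [hfdef, hx, Real.log_inv]
  have hlogi : Integrable fun x => -(f x * Real.log (f x)) := hlog ▸ hind _
  have hent : shannonEntropy f = ENNReal.log (volume T) := by
    have h := lintegral_ofReal_sub_lintegral_ofReal_neg hlogi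
    simp only [neg_neg] at h
    rw [shannonEntropy, shannonPosPart, shannonNegPart, h, hlog,
      integral_indicator_const _ hT, measureReal_def, ← hVdef, smul_eq_mul,
      mul_inv_cancel_left₀ hV.ne', ENNReal.log_pos_real h0 hfin]
  have hfr : Integrable fun x => f x * r x := by
    refine (hind (V⁻¹ * Γ)).mono' (hf.1.mul hr).aestronglyMeasurable
      (Eventually.of_forall fun x => ?_)
    by_cases hx : x ∈ T
    · simpa [hfdef, hx, abs_mul, abs_of_pos hV] using
        mul_le_mul_of_nonneg_left (hrT x hx) (inv_nonneg.2 hV.le)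
    · simp [hfdef, hx]
  have hcost : ∫ x, f x * r x ≤ Γ := by
    have h := integral_mono hfr (hf.integrable.mul_const Γ) fun x => by
      by_cases hx : x ∈ T
      · exact mul_le_mul_of_nonneg_left ((le_abs_self _).trans (hrT x hx)) (hf.2.1 x)
      · simp [hfdef, hx]
    rwa [integral_mul_const, hf.integral_eq_one, one_mul] at h
  refine le_sSup ⟨f, hf, fun x hx => Set.indicator_of_notMem (fun h => hx (hTS h)) _,
    Or.inl (lintegral_ofReal_ne_top_of_integrable hlogi),
    ⟨lintegral_ofReal_ne_top_of_integrable hfr, ?_⟩, hent.symm⟩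
  rw [lintegral_ofReal_sub_lintegral_ofReal_neg hfr]
  exact EReal.coe_le_coe_iff.2 hcost

/-- Proposition 1, second part: under Assumption (A) with constant `Γ₀`,
`h⋆(Γ) → log λ(S)` as `Γ → ∞`. -/
theorem hStar_tendsto_log_measure
    (S : Set ℝ) (hS : MeasurableSet S) (r : ℝ → ℝ) (hr : Measurable r)
    (Γ₀ : ℝ) (hA1 : (⊥ : EReal) < hStar S r Γ₀) (hA2 : ∀ Γ' ≥ Γ₀, hStar S r Γ' < ⊤) :
    Tendsto (fun Γ : ℝ => hStar S r Γ) atTop (nhds (logVol S)) := by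
  rw [logVol_eq_log_volume]
  let T : ℝ → Set ℝ := fun Γ => S ∩ {x | |r x| ≤ Γ} ∩ Set.Icc (-Γ) Γ
  have hmono : Monotone T := fun a b hab x ⟨⟨h1, h2⟩, h3, h4⟩ =>
    ⟨⟨h1, le_trans h2 hab⟩, (neg_le_neg hab).trans h3, h4.trans hab⟩
  have hunion : ⋃ Γ, T Γ = S := by
    refine Set.Subset.antisymm (Set.iUnion_subset fun Γ x hx => hx.1.1) fun x hx => ?_
    exact Set.mem_iUnion.2 ⟨max |r x| |x|, ⟨hx, le_max_left |r x| |x|⟩,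
      abs_le.1 (le_max_right _ _)⟩
  have hlim : Tendsto (fun Γ => ENNReal.log (volume (T Γ))) atTop
      (nhds (ENNReal.log (volume S))) := by
    have h := tendsto_measure_iUnion_atTop (μ := volume) hmono
    rw [hunion] at h
    exact (ENNReal.continuous_log.tendsto _).comp h
  refine tendsto_of_tendsto_of_tendsto_of_le_of_le hlim tendsto_const_nhds
    (fun Γ => ?_) fun Γ => hStar_le_log_volume hS r Γ
  exact log_volume_le_hStar
    ((hS.inter (measurableSet_le hr.abs measurable_const)).inter measurableSet_Icc)
    (fun x hx => hx.1.1) (measure_ne_top_of_subset Set.inter_subset_right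
      (by simp [Real.volume_Icc])) hr fun x hx => hx.1.2
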